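/- Let k, L, N ∈ ℕ₊ with 2^k ≤ N < 2^{k+1}, and set h̃(u,v) := max(0, g̃_{Lk}(u,v)) for u, v ∈ [0,1]. Suppose that for each nonzero p ∈ ℕ^d a function ψ_p : [0,1]^d → [0,1] is defined recursively by ψ_{e_i}(x) := x_i for each standard basis vector e_i, and, for |p| ≥ 2, ψ_p(x) := h̃(ψ_{p−e_i}(x), x_i) for some choice of i with p^{(i)} ≥ 1 (any such choice at each step). Then for every nonzero p ∈ ℕ^d and every x ∈ [0,1]^d, |ψ_p(x) − x^p| ≤ (|p|−1)·N^{−L}. -/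

import Mathlib

/-- The tent (sawtooth) map `T₁`. -/
noncomputable def T1 (x : ℝ) : ℝ := if x ≤ 1/2 then 2*x else 2*(1-x)

/-- `f̃_k(x) = x − Σ_{i=1}^k T_i(x)/4^i`, where `T_i = T₁^[i]`. -/
noncomputable def ftilde (k : ℕ) (x : ℝ) : ℝ :=
  x - ∑ i ∈ Finset.range k, T1^[i+1] x / 4^(i+1)

/-- `g̃_m(x,y) := 2 f̃_m((x+y)/2) − (1/2) f̃_m(x) − (1/2) f̃_m(y)`. -/
noncomputable def gtilde (m : ℕ) (x y : ℝ) : ℝ :=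
  2 * ftilde m ((x+y)/2) - (1/2) * ftilde m x - (1/2) * ftilde m y

theorem T1_mem_Icc {x : ℝ} (hx : x ∈ Set.Icc (0 : ℝ) 1) : T1 x ∈ Set.Icc (0 : ℝ) 1 := by
  obtain ⟨h0, h1⟩ := hx
  unfold T1
  split_ifs with h <;> constructor <;> linarith

theorem ftilde_succ (m : ℕ) (x : ℝ) :
    ftilde (m + 1) x = x - T1 x / 2 + ftilde m (T1 x) / 4 := by
  simp only [ftilde, Finset.sum_range_succ', ← Function.iterate_succ_apply]
  have h : ∑ i ∈ Finset.range m, T1^[i + 1 + 1] x / (4 : ℝ) ^ (i + 1 + 1) =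
      (∑ i ∈ Finset.range m, T1^[i + 1 + 1] x / (4 : ℝ) ^ (i + 1)) / 4 := by
    rw [Finset.sum_div]
    refine Finset.sum_congr rfl fun i _ => ?_
    rw [pow_succ _ (i + 1), div_div]
  rw [h]
  simp only [Nat.succ_eq_add_one, zero_add, Function.iterate_one, pow_one]
  ring

theorem ftilde_succ_sub_sq (m : ℕ) (x : ℝ) :
    ftilde (m + 1) x - x ^ 2 = (ftilde m (T1 x) - T1 x ^ 2) / 4 := by
  have h : x - x ^ 2 = T1 x / 2 - T1 x ^ 2 / 4 := by
    unfold T1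
    split_ifs <;> ring
  rw [ftilde_succ]
  linarith

theorem ftilde_sub_sq_mem_Icc (m : ℕ) {x : ℝ} (hx : x ∈ Set.Icc (0 : ℝ) 1) :
    ftilde m x - x ^ 2 ∈ Set.Icc (0 : ℝ) (1 / 4 ^ (m + 1)) := by
  induction m generalizing x with
  | zero =>
    obtain ⟨h0, h1⟩ := hx
    simp only [ftilde, Finset.range_zero, Finset.sum_empty, Set.mem_Icc]
    constructor <;> nlinarith [sq_nonneg (x - 1 / 2)]
  | succ m ih =>
    obtain ⟨h0, h1⟩ := ih (T1_mem_Icc hx)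
    rw [ftilde_succ_sub_sq, pow_succ, ← div_div]
    constructor <;> linarith

theorem abs_gtilde_sub_mul_le (m : ℕ) {x y : ℝ} (hx : x ∈ Set.Icc (0 : ℝ) 1)
    (hy : y ∈ Set.Icc (0 : ℝ) 1) : |gtilde m x y - x * y| ≤ 1 / 4 ^ m := by
  have hxy : (x + y) / 2 ∈ Set.Icc (0 : ℝ) 1 := by
    constructor <;> linarith [hx.1, hx.2, hy.1, hy.2]
  obtain ⟨a0, a1⟩ := ftilde_sub_sq_mem_Icc m hx
  obtain ⟨b0, b1⟩ := ftilde_sub_sq_mem_Icc m hy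
  obtain ⟨c0, c1⟩ := ftilde_sub_sq_mem_Icc m hxy
  have h : gtilde m x y - x * y = 2 * (ftilde m ((x + y) / 2) - ((x + y) / 2) ^ 2)
      - (ftilde m x - x ^ 2) / 2 - (ftilde m y - y ^ 2) / 2 := by
    unfold gtilde
    ring
  rw [pow_succ 4, ← div_div] at a1 b1 c1
  rw [h, abs_le]
  constructor <;> linarith

theorem abs_max_zero_gtilde_sub_mul_le (m : ℕ) {x y : ℝ} (hx : x ∈ Set.Icc (0 : ℝ) 1)
    (hy : y ∈ Set.Icc (0 : ℝ) 1) : |max 0 (gtilde m x y) - x * y| ≤ 1 / 4 ^ m := by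
  have h := abs_max_sub_max_le_abs (gtilde m x y) (x * y) 0
  rw [max_comm _ 0, max_eq_left (mul_nonneg hx.1 hy.1)] at h
  exact h.trans (abs_gtilde_sub_mul_le m hx hy)

theorem pow_le_four_pow {k L N : ℕ} (hk : 0 < k) (hN : N < 2 ^ (k + 1)) :
    N ^ L ≤ 4 ^ (L * k) := by
  calc N ^ L ≤ (2 ^ (k + 1)) ^ L := Nat.pow_le_pow_left hN.le L
    _ ≤ (2 ^ (2 * k)) ^ L :=
      Nat.pow_le_pow_left (Nat.pow_le_pow_right (by norm_num) (by omega)) L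
    _ = 4 ^ (L * k) := by rw [pow_mul, ← pow_mul, mul_comm k L]; norm_num

theorem sub_single_add_single {d : ℕ} {p : Fin d → ℕ} {i : Fin d} (hi : 1 ≤ p i) :
    p - Pi.single i 1 + Pi.single i 1 = p := by
  refine tsub_add_cancel_of_le fun j => ?_
  by_cases h : j = i
  · subst h
    simpa using hi
  · simp [h]

theorem sum_sub_single_add_one {d : ℕ} {p : Fin d → ℕ} {i : Fin d} (hi : 1 ≤ p i) :
    ∑ j, (p - Pi.single i 1 : Fin d → ℕ) j + 1 = ∑ j, p j := by
  conv_rhs => rw [← sub_single_add_single hi]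
  simp only [Pi.add_apply, Finset.sum_add_distrib, Finset.sum_pi_single', Finset.mem_univ, if_true]

theorem prod_pow_sub_single_mul {d : ℕ} {p : Fin d → ℕ} {i : Fin d} (hi : 1 ≤ p i)
    (x : Fin d → ℝ) : (∏ j, x j ^ (p - Pi.single i 1 : Fin d → ℕ) j) * x i = ∏ j, x j ^ p j := by
  conv_rhs => rw [← sub_single_add_single hi]
  simp only [Pi.add_apply, pow_add, Finset.prod_mul_distrib]
  congr 1
  symm
  rw [Finset.prod_eq_single i] <;> simp +contextual

/-- If `ψ_p` is defined recursively from exact first-degree monomials via the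
approximate product `h̃(u,v) = max(0, g̃_{Lk}(u,v))` (for some choice of a coordinate
`i` with `p_i ≥ 1` at each step), then `|ψ_p(x) − x^p| ≤ (|p|−1)·N^{−L}` for every
nonzero `p ∈ ℕ^d` and every `x ∈ [0,1]^d`, provided `2^k ≤ N < 2^(k+1)`. -/
theorem stmt12 (d k L N : ℕ) (hd : 0 < d) (hk : 0 < k) (hL : 0 < L) (hN : 0 < N)
    (hNlo : 2^k ≤ N) (hNhi : N < 2^(k+1))
    (ψ : (Fin d → ℕ) → (Fin d → ℝ) → ℝ)
    (hbase : ∀ (i : Fin d) (x : Fin d → ℝ), (∀ j, x j ∈ Set.Icc (0:ℝ) 1) →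
      ψ (Pi.single i 1) x = x i)
    (hrange : ∀ p : Fin d → ℕ, p ≠ 0 → ∀ x : Fin d → ℝ,
      (∀ j, x j ∈ Set.Icc (0:ℝ) 1) → ψ p x ∈ Set.Icc (0:ℝ) 1)
    (hrec : ∀ p : Fin d → ℕ, 2 ≤ ∑ i, p i → ∃ i : Fin d, 1 ≤ p i ∧
      ∀ x : Fin d → ℝ, (∀ j, x j ∈ Set.Icc (0:ℝ) 1) →
        ψ p x = max 0 (gtilde (L*k) (ψ (p - Pi.single i 1) x) (x i))) :
    ∀ p : Fin d → ℕ, p ≠ 0 → ∀ x : Fin d → ℝ, (∀ j, x j ∈ Set.Icc (0:ℝ) 1) →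
      |ψ p x - ∏ i, x i ^ p i| ≤ (((∑ i, p i : ℕ) : ℝ) - 1) / (N : ℝ)^L := by
  intro p hp x hx
  induction hn : ∑ i, p i using Nat.strong_induction_on generalizing p with
  | _ n ih =>
  subst hn
  obtain ⟨i₀, hi₀⟩ := Function.ne_iff.mp hp
  have hpos : 1 ≤ p i₀ := Nat.one_le_iff_ne_zero.mpr hi₀
  have hsum₀ := sum_sub_single_add_one hpos
  rcases Nat.lt_or_ge (∑ i, p i) 2 with hlt | hge
  · have hone : ∑ i, p i = 1 := by omega
    have hzero : p - Pi.single i₀ 1 = 0 := by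
      have h0 : ∑ j, (p - Pi.single i₀ 1 : Fin d → ℕ) j = 0 := by omega
      funext j
      exact Finset.sum_eq_zero_iff.mp h0 j (Finset.mem_univ j)
    have hprod := prod_pow_sub_single_mul hpos x
    have hsingle := sub_single_add_single hpos
    simp only [hzero, Pi.zero_apply, pow_zero, Finset.prod_const_one, one_mul] at hprod
    rw [hzero, zero_add] at hsingle
    rw [← hprod, ← hsingle, hbase i₀ x hx, hsingle, hone]
    simp
  · obtain ⟨i, hi, hψ⟩ := hrec p hge
    have hsum := sum_sub_single_add_one hi
    have hq : p - Pi.single i 1 ≠ 0 := by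
      intro h
      simp only [h, Pi.zero_apply, Finset.sum_const_zero] at hsum
      omega
    have hih := ih _ (by omega) _ hq rfl
    have hstep := abs_max_zero_gtilde_sub_mul_le (L * k) (hrange _ hq x hx) (hx i)
    have hpow : (1 : ℝ) / 4 ^ (L * k) ≤ 1 / (N : ℝ) ^ L :=
      one_div_le_one_div_of_le (by positivity) (by exact_mod_cast pow_le_four_pow hk hNhi)
    rw [hψ x hx, ← prod_pow_sub_single_mul hi x, ← hsum]
    set q := p - Pi.single i 1
    have hmul : |ψ q x * x i - (∏ j, x j ^ q j) * x i| ≤ |ψ q x - ∏ j, x j ^ q j| := by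
      rw [← sub_mul, abs_mul, abs_of_nonneg (hx i).1]
      exact mul_le_of_le_one_right (abs_nonneg _) (hx i).2
    calc _ ≤ _ := abs_sub_le _ (ψ q x * x i) _
      _ ≤ 1 / (N : ℝ) ^ L + (((∑ j, q j : ℕ) : ℝ) - 1) / (N : ℝ) ^ L :=
        add_le_add (hstep.trans hpow) (hmul.trans hih)
      _ = _ := by
        rw [← add_div, Nat.cast_add, Nat.cast_one]
        ring
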